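/- The union ⋃_{N≥1} F_N of the sets F_N over all integers N ≥ 1 has Hausdorff dimension exactly 1. -/

import Mathlib

/-- `FN N` is the set of `ψ ∈ [0,1]` admitting a binary expansion
`ψ = Σ_{k≥1} ε_k 2^{-k}` (digits `ε k ∈ {0,1}`, here indexed from `0`) whose digit
sequence contains no `N+2` consecutive equal digits. -/
def FN (N : ℕ) : Set ℝ :=
  {ψ | ∃ ε : ℕ → ℕ, (∀ k, ε k ≤ 1) ∧
    ψ = ∑' k : ℕ, (ε k : ℝ) / 2 ^ (k + 1) ∧
    ∀ k : ℕ, ∃ j ≤ N + 1, ε (k + j) ≠ ε k}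

open Filter Topology

open scoped NNReal ENNReal

namespace Real

/-- If two digit sequences agree before position `n` and their `n`-th digits differ by at least
two, then the corresponding numbers differ by at least `b⁻⁽ⁿ⁺¹⁾`. -/
theorem inv_pow_le_ofDigits_sub_ofDigits {b n : ℕ} {x y : ℕ → Fin b}
    (hxy : ∀ i < n, x i = y i) (hn : (x n : ℕ) + 2 ≤ y n) :
    ((b : ℝ) ^ (n + 1))⁻¹ ≤ ofDigits y - ofDigits x := by
  rw [ofDigits_eq_sum_add_ofDigits x (n + 1), ofDigits_eq_sum_add_ofDigits y (n + 1),
    Finset.sum_range_succ, Finset.sum_range_succ]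
  have hsum : ∑ i ∈ Finset.range n, ofDigitsTerm x i = ∑ i ∈ Finset.range n, ofDigitsTerm y i :=
    Finset.sum_congr rfl fun i hi ↦ by simp [ofDigitsTerm, hxy i (Finset.mem_range.mp hi)]
  have hn' : (x n : ℝ) + 2 ≤ y n := mod_cast hn
  have hx := ofDigits_le_one fun i ↦ x (i + (n + 1))
  have hy := ofDigits_nonneg fun i ↦ y (i + (n + 1))
  have hb : 0 ≤ ((b : ℝ) ^ (n + 1))⁻¹ := by positivity
  rw [hsum, ofDigitsTerm, ofDigitsTerm]
  nlinarith

/-- A number whose first digit is not the largest one is less than one. -/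
theorem ofDigits_lt_one {b : ℕ} {x : ℕ → Fin b} (hx : (x 0 : ℕ) + 2 ≤ b) : ofDigits x < 1 := by
  have hb : (0 : ℝ) < b := mod_cast (x 0).pos
  have hx' : (x 0 : ℝ) + 2 ≤ b := mod_cast hx
  have ht := ofDigits_le_one fun i ↦ x (i + 1)
  rw [ofDigits_eq_sum_add_ofDigits x 1]
  simp only [Finset.range_one, Finset.sum_singleton, ofDigitsTerm, zero_add, pow_one]
  rw [mul_comm, ← mul_add, inv_mul_lt_iff₀ hb]
  linarith

theorem exists_natCast_eq_pow_mul_sum_ofDigitsTerm {b : ℕ} (x : ℕ → Fin b) (n : ℕ) :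
    ∃ K : ℕ, (b : ℝ) ^ n * ∑ i ∈ Finset.range n, ofDigitsTerm x i = K := by
  have hb : (b : ℝ) ≠ 0 := mod_cast (x 0).pos.ne'
  induction n with
  | zero => exact ⟨0, by simp⟩
  | succ n ih =>
    obtain ⟨K, hK⟩ := ih
    refine ⟨b * K + x n, ?_⟩
    rw [Finset.sum_range_succ, ofDigitsTerm]
    push_cast
    rw [← hK]
    field_simp
    ring

/-- The integer part of `bⁿ⁺¹ x` ends in the `n`-th digit of `x`, unless the remaining digits
represent one. -/
theorem floor_pow_mul_ofDigits_mod {b n : ℕ} {x : ℕ → Fin b}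
    (hx : ofDigits (fun i ↦ x (i + (n + 1))) < 1) :
    ⌊(b : ℝ) ^ (n + 1) * ofDigits x⌋₊ % b = x n := by
  have hb : (b : ℝ) ≠ 0 := mod_cast (x 0).pos.ne'
  obtain ⟨K, hK⟩ := exists_natCast_eq_pow_mul_sum_ofDigitsTerm x n
  have h0 := ofDigits_nonneg fun i ↦ x (i + (n + 1))
  have h : (b : ℝ) ^ (n + 1) * ofDigits x =
      ((b * K + x n : ℕ) : ℝ) + ofDigits (fun i ↦ x (i + (n + 1))) := by
    rw [ofDigits_eq_sum_add_ofDigits x (n + 1), Finset.sum_range_succ, ofDigitsTerm]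
    push_cast
    rw [← hK]
    field_simp
    ring
  have hfloor : ⌊(b : ℝ) ^ (n + 1) * ofDigits x⌋₊ = b * K + x n := by
    rw [Nat.floor_eq_iff (by rw [h]; positivity), h]
    constructor <;> linarith
  rw [hfloor, Nat.mul_add_mod, Nat.mod_eq_of_lt (x n).isLt]

end Real

/-- Append the two binary digits `01` to an `m`-digit binary block. -/
def appendZeroOne (m : ℕ) (d : Fin (2 ^ m)) : Fin (2 ^ (m + 2)) :=
  ⟨4 * d + 1, by have := d.isLt; rw [pow_add]; lia⟩

/-- Rewrite `x ∈ [0, 1)` by inserting `01` after each block of `m` binary digits. -/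
noncomputable def insertZeroOne (m : ℕ) (x : ℝ) : ℝ :=
  Real.ofDigits fun n ↦ appendZeroOne m (Real.digits x (2 ^ m) n)

theorem ofDigits_appendZeroOne_lt_one {m : ℕ} (a : ℕ → Fin (2 ^ m)) :
    Real.ofDigits (fun n ↦ appendZeroOne m (a n)) < 1 := by
  refine Real.ofDigits_lt_one ?_
  have := (a 0).isLt
  simp only [appendZeroOne, pow_add]
  lia

theorem insertZeroOne_mem_Ico (m : ℕ) (x : ℝ) : insertZeroOne m x ∈ Set.Ico 0 1 :=
  ⟨Real.ofDigits_nonneg _, ofDigits_appendZeroOne_lt_one _⟩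

theorem floor_pow_mul_insertZeroOne_mod_four (m n : ℕ) (x : ℝ) :
    ⌊((2 : ℝ) ^ ((m + 2) * (n + 1))) * insertZeroOne m x⌋₊ % 4 = 1 := by
  have h := Real.floor_pow_mul_ofDigits_mod (n := n)
    (x := fun n ↦ appendZeroOne m (Real.digits x (2 ^ m) n)) (ofDigits_appendZeroOne_lt_one _)
  have hdvd : 4 ∣ 2 ^ (m + 2) := ⟨2 ^ m, by ring⟩
  rw [pow_mul, ← Nat.mod_mod_of_dvd _ hdvd]
  push_cast at h
  rw [insertZeroOne, h, appendZeroOne]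
  lia

theorem insertZeroOne_mem_FN (m : ℕ) (x : ℝ) : insertZeroOne m x ∈ FN (2 * m + 3) := by
  set y := insertZeroOne m x
  have hval (k : ℕ) : (Real.digits y 2 k : ℕ) = ⌊(2 : ℝ) ^ (k + 1) * y⌋₊ % 2 := by
    simp [Real.digits, mul_comm]
  refine ⟨fun k ↦ Real.digits y 2 k, fun k ↦ Nat.le_of_lt_succ (Real.digits y 2 k).isLt, ?_, ?_⟩
  · simpa [Real.ofDigits, Real.ofDigitsTerm, div_eq_mul_inv] using
      (Real.ofDigits_digits one_lt_two (insertZeroOne_mem_Ico m x)).symm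
  · intro k
    obtain ⟨p, hkp, hpk, hp⟩ : ∃ p, k ≤ p ∧ p + 1 ≤ k + (2 * m + 4) ∧
        ⌊(2 : ℝ) ^ (p + 2) * y⌋₊ % 4 = 1 := by
      have h₁ := Nat.div_add_mod k (m + 2)
      have h₂ := Nat.mod_lt k (show 0 < m + 2 by lia)
      refine ⟨(m + 2) * (k / (m + 2)) + (2 * m + 2), by lia, by lia, ?_⟩
      rw [show (m + 2) * (k / (m + 2)) + (2 * m + 2) + 2 = (m + 2) * (k / (m + 2) + 1 + 1) by ring]
      exact floor_pow_mul_insertZeroOne_mod_four m (k / (m + 2) + 1) x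
    have hzero : (Real.digits y 2 p : ℕ) = 0 := by
      have hdiv : (2 : ℝ) ^ (p + 1) * y = 2 ^ (p + 2) * y / (2 : ℕ) := by
        push_cast
        ring
      rw [hval, hdiv, Nat.floor_div_natCast]
      lia
    have hone : (Real.digits y 2 (p + 1) : ℕ) = 1 := by
      rw [hval]
      lia
    by_cases hk : (Real.digits y 2 k : ℕ) = 0
    · refine ⟨p + 1 - k, by lia, ?_⟩
      rw [show k + (p + 1 - k) = p + 1 by lia]
      beta_reduce
      rw [hone, hk]
      exact one_ne_zero
    · refine ⟨p - k, by lia, ?_⟩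
      rw [show k + (p - k) = p by lia]
      beta_reduce
      rw [hzero]
      exact Ne.symm hk

theorem abs_sub_le_mul_abs_ofDigits_appendZeroOne_sub_rpow {m : ℕ} (a b : ℕ → Fin (2 ^ m)) :
    |Real.ofDigits a - Real.ofDigits b| ≤
      2 ^ m * |Real.ofDigits (fun n ↦ appendZeroOne m (a n)) -
        Real.ofDigits (fun n ↦ appendZeroOne m (b n))| ^ ((m : ℝ) / (m + 2)) := by
  obtain rfl | hab := eq_or_ne a b
  · simp only [sub_self, abs_zero]
    positivity
  classical
  obtain ⟨n, hn, hmin⟩ : ∃ n, a n ≠ b n ∧ ∀ i < n, a i = b i :=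
    have h := Function.ne_iff.mp hab
    ⟨Nat.find h, Nat.find_spec h, fun i hi ↦ not_not.mp (Nat.find_min h hi)⟩
  have hgap : (((2 ^ (m + 2) : ℕ) : ℝ) ^ (n + 1))⁻¹ ≤
      |Real.ofDigits (fun n ↦ appendZeroOne m (a n)) -
        Real.ofDigits (fun n ↦ appendZeroOne m (b n))| := by
    obtain h | h := lt_or_gt_of_ne hn
    · rw [abs_sub_comm]
      refine (Real.inv_pow_le_ofDigits_sub_ofDigits (fun i hi ↦ ?_) ?_).trans (le_abs_self _)
      · simp only [hmin i hi]
      · simp only [appendZeroOne]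
        lia
    · refine (Real.inv_pow_le_ofDigits_sub_ofDigits (fun i hi ↦ ?_) ?_).trans (le_abs_self _)
      · simp only [hmin i hi]
      · simp only [appendZeroOne]
        lia
  calc |Real.ofDigits a - Real.ofDigits b|
      ≤ (((2 ^ m : ℕ) : ℝ) ^ n)⁻¹ := Real.abs_ofDigits_sub_ofDigits_le hmin
    _ = 2 ^ m * ((((2 ^ (m + 2) : ℕ) : ℝ) ^ (n + 1))⁻¹) ^ ((m : ℝ) / (m + 2)) := by
      have hexp : ((((2 ^ (m + 2) : ℕ) : ℝ) ^ (n + 1))⁻¹) ^ ((m : ℝ) / (m + 2)) =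
          ((2 : ℝ) ^ (m * (n + 1)))⁻¹ := by
        rw [Real.inv_rpow (by positivity)]
        push_cast
        rw [← pow_mul, ← Real.rpow_natCast, ← Real.rpow_mul zero_le_two, ← Real.rpow_natCast]
        congr 2
        push_cast
        field_simp
      rw [hexp]
      push_cast
      rw [← pow_mul, mul_add, mul_one, pow_add]
      field_simp
    _ ≤ _ := by gcongr

theorem div_le_dimH_iUnion_FN {m : ℕ} (hm : 1 ≤ m) :
    (((m : ℝ≥0) / (m + 2) : ℝ≥0) : ℝ≥0∞) ≤ dimH (⋃ (N : ℕ) (_ : 1 ≤ N), FN N) := by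
  have hb : 1 < 2 ^ m := Nat.one_lt_two_pow (by lia)
  have hanti : ∀ x ∈ Set.Ico (0 : ℝ) 1, ∀ y ∈ Set.Ico (0 : ℝ) 1,
      |x - y| ≤ 2 ^ m * |insertZeroOne m x - insertZeroOne m y| ^ ((m : ℝ) / (m + 2)) := by
    intro x hx y hy
    have h := abs_sub_le_mul_abs_ofDigits_appendZeroOne_sub_rpow
      (Real.digits x (2 ^ m)) (Real.digits y (2 ^ m))
    rwa [Real.ofDigits_digits hb hx, Real.ofDigits_digits hb hy] at h
  have hr : 0 < (m : ℝ) / (m + 2) := by positivity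
  have hinj : Set.InjOn (insertZeroOne m) (Set.Ico 0 1) := by
    intro x hx y hy hxy
    have h := hanti x hx y hy
    rw [hxy, sub_self, abs_zero, Real.zero_rpow hr.ne', mul_zero] at h
    exact sub_eq_zero.mp (abs_nonpos_iff.mp h)
  have hinv := hinj.leftInvOn_invFunOn
  set f := Function.invFunOn (insertZeroOne m) (Set.Ico 0 1)
  have hholder : HolderOnWith (2 ^ m) ((m : ℝ≥0) / (m + 2)) f
      (insertZeroOne m '' Set.Ico 0 1) := by
    rintro _ ⟨x, hx, rfl⟩ _ ⟨y, hy, rfl⟩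
    rw [hinv hx, hinv hy, edist_dist, edist_dist, Real.dist_eq, Real.dist_eq,
      ENNReal.ofReal_rpow_of_nonneg (abs_nonneg _) (by positivity), ← ENNReal.ofReal_coe_nnreal,
      ← ENNReal.ofReal_mul (by positivity)]
    refine ENNReal.ofReal_le_ofReal ?_
    push_cast
    exact hanti x hx y hy
  have hdim := hholder.dimH_image_le (by positivity)
  rw [hinv.image_image, Real.dimH_of_nonempty_interior (by simp), Module.finrank_self,
    Nat.cast_one, ENNReal.le_div_iff_mul_le (.inl (by simp; lia))
      (.inl ENNReal.coe_ne_top), one_mul] at hdim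
  refine hdim.trans (dimH_mono ?_)
  rintro _ ⟨x, -, rfl⟩
  exact Set.mem_biUnion (show 1 ≤ 2 * m + 3 by lia) (insertZeroOne_mem_FN m x)

/-- The union of the sets F_N over all integers N ≥ 1 has Hausdorff dimension exactly 1. -/
theorem stmt_2 : dimH (⋃ (N : ℕ) (_ : 1 ≤ N), FN N) = 1 := by
  refine le_antisymm ((dimH_mono (Set.subset_univ _)).trans_eq Real.dimH_univ) ?_
  have hlim : Tendsto (fun m : ℕ ↦ (((m : ℝ≥0) / (m + 2) : ℝ≥0) : ℝ≥0∞)) atTop (𝓝 1) := by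
    rw [← ENNReal.coe_one, ENNReal.tendsto_coe, ← NNReal.tendsto_coe]
    push_cast
    exact tendsto_natCast_div_add_atTop (2 : ℝ)
  exact le_of_tendsto hlim ((eventually_ge_atTop 1).mono fun m hm ↦ div_le_dimH_iUnion_FN hm)
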